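/- Let (Γ_i)_{i ∈ I} be a countable family of countable ICC groups and let Γ be their direct sum, i.e., the subgroup of the product ∏_{i ∈ I} Γ_i consisting of those elements f such that f(i) is the identity for all but finitely many i. Let a be a measure-preserving action of Γ on a standard probability space (X, μ). If for every i ∈ I the restriction of a to the canonical copy of Γ_i in Γ (the image of the embedding sending g ∈ Γ_i to the element equal to g in coordinate i and the identity in all other coordinates) is essentially free, then a is essentially free. -/

import Mathlib

open MeasureTheory

/-- The direct sum of the groups `Γ i`: the subgroup of the product `∀ i, Γ i`
consisting of elements equal to the identity in all but finitely many coordinates. -/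
def directSumSubgroup {I : Type*} (Γ : I → Type*) [∀ i, Group (Γ i)] :
    Subgroup (∀ i, Γ i) where
  carrier := {f | {i | f i ≠ 1}.Finite}
  one_mem' := by simp
  mul_mem' := by
    intro f g hf hg
    refine (hf.union hg).subset fun i hi => ?_
    by_contra h
    simp only [Set.mem_union, Set.mem_setOf_eq, not_or, not_not] at h
    exact hi (by simp [Pi.mul_apply, h.1, h.2])
  inv_mem' := by
    intro f hf
    refine hf.subset fun i hi => ?_
    simp only [Set.mem_setOf_eq, Pi.inv_apply, ne_eq, inv_eq_one] at hi ⊢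
    exact hi

/-- The canonical copy of `Γ i` sits inside the direct sum. -/
theorem mulSingle_mem_directSumSubgroup {I : Type*} [DecidableEq I]
    (Γ : I → Type*) [∀ i, Group (Γ i)] (i : I) (g : Γ i) :
    Pi.mulSingle i g ∈ directSumSubgroup Γ :=
  (Set.finite_singleton i).subset fun j hj => by
    by_contra h
    exact hj (Pi.mulSingle_eq_of_ne (by simpa using h) g)

/-- In a finite measure space, infinitely many pairwise almost disjoint null-measurable sets of the
same measure are null. -/
theorem measure_eq_zero_of_infinite_aedisjoint {ι X : Type*} [Infinite ι] [MeasurableSpace X]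
    {μ : Measure X} [IsFiniteMeasure μ] {s : ι → Set X} {c : ENNReal}
    (hmeas : ∀ i, NullMeasurableSet (s i) μ)
    (hdisj : Pairwise (Function.onFun (AEDisjoint μ) s)) (hs : ∀ i, μ (s i) = c) : c = 0 := by
  by_contra hc
  have hfin := Measure.finite_const_le_meas_of_disjoint_iUnion₀ μ (pos_iff_ne_zero.mpr hc)
    hmeas hdisj (measure_ne_top μ _)
  simp only [hs, le_refl, Set.ofPred_true] at hfin
  exact Set.infinite_univ hfin

/-- For a measure-preserving action, conjugate elements have fixed-point sets of equal measure. -/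
theorem measure_fixedPoints_conj {G X : Type*} [Group G] [MulAction G X] [MeasurableSpace X]
    {μ : Measure X} (hpres : ∀ g : G, MeasurePreserving (fun x : X => g • x) μ μ)
    (hFix : ∀ g : G, MeasurableSet {x : X | g • x = x}) (a g : G) :
    μ {x : X | (a * g * a⁻¹) • x = x} = μ {x : X | g • x = x} := by
  rw [← (hpres a⁻¹).measure_preimage (hFix g).nullMeasurableSet]
  congr 1
  ext x
  simp only [Set.mem_ofPred_eq, Set.mem_preimage, mul_smul]
  exact smul_eq_iff_eq_inv_smul a

/-- The quotient of two conjugates of `f` by elements of the `i`-th factor lies in that factor. -/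
theorem mulSingle_conj_mul_inv {I : Type*} [DecidableEq I] {Γ : I → Type*} [∀ i, Group (Γ i)]
    (i : I) (f : ∀ i, Γ i) (d e : Γ i) :
    (Pi.mulSingle i d * f * (Pi.mulSingle i d)⁻¹) * (Pi.mulSingle i e * f * (Pi.mulSingle i e)⁻¹)⁻¹
      = Pi.mulSingle i ((d * f i * d⁻¹) * (e * f i * e⁻¹)⁻¹) := by
  ext j
  by_cases hj : j = i
  · subst hj
    simp
  · simp [Pi.mulSingle_eq_of_ne hj]

/-- Proposition 4.10: a measure-preserving action of a direct sum of countable ICC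
groups is essentially free provided its restriction to each canonical copy `Γ i` is
essentially free. -/
theorem directSum_essentially_free_of_components
    {I : Type*} [Countable I] [DecidableEq I]
    (Γ : I → Type*) [∀ i, Group (Γ i)] [∀ i, Countable (Γ i)]
    (hICC : ∀ i, ∀ g : Γ i, g ≠ 1 → {x : Γ i | ∃ δ : Γ i, δ * g * δ⁻¹ = x}.Infinite)
    {X : Type*} [MeasurableSpace X] [StandardBorelSpace X]
    (μ : Measure X) [IsProbabilityMeasure μ]
    [MulAction ↥(directSumSubgroup Γ) X]
    (hpres : ∀ γ : ↥(directSumSubgroup Γ), MeasurePreserving (fun x : X => γ • x) μ μ)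
    (hFix : ∀ γ : ↥(directSumSubgroup Γ), MeasurableSet {x : X | γ • x = x})
    (hfree : ∀ (i : I) (g : Γ i), g ≠ 1 →
      μ {x : X | (⟨Pi.mulSingle i g, mulSingle_mem_directSumSubgroup Γ i g⟩ :
          ↥(directSumSubgroup Γ)) • x = x} = 0) :
    ∀ γ : ↥(directSumSubgroup Γ), γ ≠ 1 → μ {x : X | γ • x = x} = 0 := by
  intro γ hγ
  obtain ⟨i, hi⟩ : ∃ i, γ.1 i ≠ 1 := by
    by_contra! h
    exact hγ (Subtype.ext (funext h))
  have : Infinite {x : Γ i | ∃ δ : Γ i, δ * γ.1 i * δ⁻¹ = x} := (hICC i _ hi).to_subtype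
  choose d hd using fun x : {x : Γ i | ∃ δ : Γ i, δ * γ.1 i * δ⁻¹ = x} => x.2
  let a x : directSumSubgroup Γ :=
    ⟨Pi.mulSingle i (d x), mulSingle_mem_directSumSubgroup Γ i (d x)⟩
  refine measure_eq_zero_of_infinite_aedisjoint (s := fun x => {p : X | (a x * γ * (a x)⁻¹) • p = p})
    (fun x => (hFix _).nullMeasurableSet) (fun x y hxy => ?_)
    (fun x => measure_fixedPoints_conj hpres hFix (a x) γ)
  have hne : x.1 * y.1⁻¹ ≠ 1 := fun h => hxy (Subtype.ext (mul_inv_eq_one.mp h))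
  have hquot : (a x * γ * (a x)⁻¹) * (a y * γ * (a y)⁻¹)⁻¹ =
      ⟨Pi.mulSingle i (x.1 * y.1⁻¹), mulSingle_mem_directSumSubgroup Γ i _⟩ := by
    refine Subtype.ext ((mulSingle_conj_mul_inv i γ.1 (d x) (d y)).trans ?_)
    rw [hd x, hd y]
  refine measure_mono_null (fun p hp => ?_) (hfree i _ hne)
  rw [Set.mem_ofPred_eq, ← hquot, mul_smul, inv_smul_eq_iff.mpr hp.2.symm]
  exact hp.1
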